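/- Let (W, S) be a Coxeter system and H ⊆ S. There do not exist pairwise distinct elements f, d, u, b, c, a ∈ W such that, in the Bruhat order, f is covered by d and by u, each of d and u is covered by each of b and c, each of b and c is covered by a, with a, b, c ∉ W^H and u, f ∈ W^H. -/

import Mathlib

open Polynomial

section Bruhat

variable {B : Type*} {W : Type*} [Group W] {Mat : CoxeterMatrix B} (cs : CoxeterSystem Mat W)

/-- One step of the Bruhat order on a Coxeter group: multiply on the right by a
reflection and increase the length. -/
def bstep (u v : W) : Prop :=
  (∃ t : W, cs.IsReflection t ∧ v = u * t) ∧ cs.length u < cs.length v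

/-- The Bruhat order `≤` on the Coxeter group `W`. -/
def ble (u v : W) : Prop :=
  Relation.ReflTransGen (bstep cs) u v

/-- Strict Bruhat order. -/
def blt (u v : W) : Prop := ble cs u v ∧ u ≠ v

/-- Covering relation of the Bruhat order. -/
def bcov (u v : W) : Prop :=
  blt cs u v ∧ ∀ z : W, ble cs u z → ble cs z v → z = u ∨ z = v

/-- The set `W^H` of minimal coset representatives:
`w` with `ℓ(w s) > ℓ(w)` for all `s ∈ H`. -/
def WH (H : Set B) : Set W :=
  {w | ∀ i ∈ H, cs.length w < cs.length (w * cs.simple i)}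

end Bruhat

section StrongExchange

namespace CoxeterSystem

variable {B : Type*} {W : Type*} [Group W] {Mat : CoxeterMatrix B} (cs : CoxeterSystem Mat W)

open Classical in
/-- The action of a simple reflection on `W × ZMod 2`: conjugate the first component, and flip
the sign exactly when the first component is the simple reflection itself. -/
noncomputable def signedConj (i : B) : Function.End (W × ZMod 2) := fun p =>
  (cs.simple i * p.1 * cs.simple i, p.2 + if p.1 = cs.simple i then 1 else 0)

theorem signedConj_apply (i : B) (t : W) (ε : ZMod 2) [Decidable (t = cs.simple i)] :
    cs.signedConj i (t, ε) =
      (cs.simple i * t * cs.simple i, ε + if t = cs.simple i then 1 else 0) := by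
  simp only [signedConj]
  congr

theorem simple_mul_pow_mul_simple (i j : B) (n : ℕ) :
    cs.simple j * (cs.simple i * cs.simple j) ^ n * cs.simple j =
      ((cs.simple i * cs.simple j) ^ n)⁻¹ := by
  have h := (conj_pow (i := n) (a := cs.simple j) (b := cs.simple i * cs.simple j)).symm
  simp only [inv_simple] at h
  rw [h, ← inv_pow]
  simp [mul_assoc]

open Classical in
theorem signedConj_mul_pow (i j : B) (n : ℕ) (t : W) (ε : ZMod 2) :
    ((cs.signedConj i * cs.signedConj j) ^ n) (t, ε) =
      ((cs.simple i * cs.simple j) ^ n * t * ((cs.simple i * cs.simple j) ^ n)⁻¹,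
        ε + ∑ m ∈ Finset.range (2 * n),
          if t = cs.simple j * (cs.simple i * cs.simple j) ^ m then 1 else 0) := by
  induction n with
  | zero => simp [Function.End.one_def]
  | succ n ih =>
    have hconj := cs.simple_mul_pow_mul_simple i j n
    set r := cs.simple i * cs.simple j with hr
    have hsr : cs.simple j * r ^ n = (r ^ n)⁻¹ * cs.simple j := by
      rw [← hconj]; simp
    have h₁ : r ^ n * t * (r ^ n)⁻¹ = cs.simple j ↔ t = cs.simple j * r ^ (2 * n) := by
      rw [mul_inv_eq_iff_eq_mul, ← eq_inv_mul_iff_mul_eq, two_mul, pow_add, ← mul_assoc,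
        ← mul_assoc, hsr]
    have h₂ : cs.simple j * (r ^ n * t * (r ^ n)⁻¹) * cs.simple j = cs.simple i ↔
        t = cs.simple j * r ^ (2 * n + 1) := by
      have e : cs.simple j * r ^ (2 * n + 1) =
          (r ^ n)⁻¹ * (cs.simple j * cs.simple i * cs.simple j) * r ^ n := by
        rw [show 2 * n + 1 = n + (1 + n) by ring, pow_add, pow_add, pow_one, ← mul_assoc, hsr]
        simp only [mul_assoc, hr]
      rw [e]
      constructor
      · intro h
        rw [← h]
        simp [mul_assoc]
      · rintro rfl
        simp [mul_assoc]
    have hmul (f g : Function.End (W × ZMod 2)) (p : W × ZMod 2) : (f * g) p = f (g p) := rfl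
    rw [pow_succ', hmul, ih, hmul, signedConj_apply, signedConj_apply]
    refine Prod.ext ?_ ?_
    · rw [pow_succ' r n]
      simp [hr, mul_assoc]
    · simp only [h₁, h₂]
      rw [show 2 * (n + 1) = 2 * n + 1 + 1 by ring, Finset.sum_range_succ, Finset.sum_range_succ]
      ring

theorem isLiftable_signedConj : Mat.IsLiftable cs.signedConj := by
  classical
  intro i j
  funext ⟨t, ε⟩
  rw [signedConj_mul_pow, two_mul, Finset.sum_range_add]
  simp [pow_add, Function.End.one_def, CharTwo.add_self_eq_zero]

/-- The homomorphism from `W` to the self-maps of `W × ZMod 2` extending `signedConj`. -/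
noncomputable def signedAction : W →* Function.End (W × ZMod 2) :=
  cs.lift ⟨cs.signedConj, cs.isLiftable_signedConj⟩

theorem signedAction_simple (i : B) : cs.signedAction (cs.simple i) = cs.signedConj i :=
  cs.lift_apply_simple cs.isLiftable_signedConj i

theorem signedAction_mul_apply (u v : W) (p : W × ZMod 2) :
    cs.signedAction (u * v) p = cs.signedAction u (cs.signedAction v p) := by
  rw [map_mul]; rfl

theorem signedAction_wordProd [DecidableEq W] (ω : List B) (t : W) (ε : ZMod 2) :
    cs.signedAction (cs.wordProd ω) (t, ε) =
      (cs.wordProd ω * t * (cs.wordProd ω)⁻¹, ε + ((cs.rightInvSeq ω).count t : ZMod 2)) := by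
  induction ω with
  | nil => simp [Function.End.one_def]
  | cons i ω ih =>
    rw [wordProd_cons, signedAction_mul_apply, ih, signedAction_simple, signedConj_apply]
    refine Prod.ext ?_ ?_
    · simp [mul_assoc]
    · have h : cs.wordProd ω * t * (cs.wordProd ω)⁻¹ = cs.simple i ↔
          (cs.wordProd ω)⁻¹ * cs.simple i * cs.wordProd ω = t := by
        rw [mul_inv_eq_iff_eq_mul, mul_assoc, inv_mul_eq_iff_eq_mul, eq_comm]
      simp only [rightInvSeq, List.count_cons, h, beq_iff_eq]
      push_cast
      ring

theorem exists_signedAction_eq (w t : W) :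
    ∃ δ : ZMod 2, ∀ ε, cs.signedAction w (t, ε) = (w * t * w⁻¹, ε + δ) := by
  classical
  obtain ⟨ω, rfl⟩ := cs.wordProd_surjective w
  exact ⟨_, fun ε => cs.signedAction_wordProd ω t ε⟩

theorem IsReflection.signedAction_self {t : W} (ht : cs.IsReflection t) (ε : ZMod 2) :
    cs.signedAction t (t, ε) = (t, ε + 1) := by
  classical
  obtain ⟨u, i, rfl⟩ := ht
  obtain ⟨δ, hδ⟩ := cs.exists_signedAction_eq u (cs.simple i)
  have hinv : cs.signedAction u⁻¹ (u * cs.simple i * u⁻¹, ε) = (cs.simple i, ε - δ) := by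
    have h : (u * cs.simple i * u⁻¹, ε) = cs.signedAction u (cs.simple i, ε - δ) := by
      rw [hδ, sub_add_cancel]
    rw [h, ← signedAction_mul_apply, inv_mul_cancel, map_one]
    rfl
  rw [signedAction_mul_apply, hinv, signedAction_mul_apply, signedAction_simple, signedConj_apply]
  simp only [simple_mul_simple_self, one_mul, if_true]
  rw [hδ]
  refine Prod.ext rfl ?_
  simp only
  ring

/-- The strong exchange property: every right inversion of `π ω` occurs in the right inversion
sequence of `ω`. -/
theorem IsRightInversion.mem_rightInvSeq {ω : List B} {t : W}
    (h : cs.IsRightInversion (cs.wordProd ω) t) : t ∈ cs.rightInvSeq ω := by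
  classical
  obtain ⟨ht, hlt⟩ := h
  by_contra hmem
  obtain ⟨ω', hω', hprod⟩ := cs.exists_isReduced (cs.wordProd ω * t)
  have h₁ := cs.signedAction_mul_apply (cs.wordProd ω) t (t, 0)
  rw [ht.signedAction_self, signedAction_wordProd, List.count_eq_zero_of_not_mem hmem, hprod,
    signedAction_wordProd] at h₁
  have h₂ := congrArg Prod.snd h₁
  have hmem' : t ∈ cs.rightInvSeq ω' := by
    by_contra hn
    simp [List.count_eq_zero_of_not_mem hn] at h₂
  have h₃ := (cs.isRightInversion_of_mem_rightInvSeq hω' hmem').2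
  rw [← hprod, mul_assoc, ht.mul_self, mul_one] at h₃
  exact lt_asymm hlt h₃

/-- A right inversion of `w` is either `s i` or conjugate under `s i` to a right inversion of
`w * s i`. -/
theorem IsRightInversion.eq_simple_or_length_lt {w t : W} {i : B}
    (ht : cs.IsRightInversion w t) :
    t = cs.simple i ∨ cs.length (w * t * cs.simple i) < cs.length (w * cs.simple i) := by
  obtain ⟨ω, hω, hprod⟩ := cs.exists_isReduced (w * cs.simple i)
  have hw : w = cs.wordProd (ω.concat i) := by
    rw [wordProd_concat, ← hprod, simple_mul_simple_cancel_right]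
  have hmem : t ∈ cs.rightInvSeq (ω.concat i) :=
    IsRightInversion.mem_rightInvSeq cs (hw ▸ ht)
  rw [rightInvSeq_concat, List.concat_eq_append, List.mem_append, List.mem_singleton,
    List.mem_map] at hmem
  obtain ⟨r, hr, rfl⟩ | h := hmem
  · right
    have h := (cs.isRightInversion_of_mem_rightInvSeq hω hr).2
    rw [← hprod] at h
    simpa [mul_assoc] using h
  · exact Or.inl h

end CoxeterSystem

end StrongExchange

section Covers

variable {B : Type*} {W : Type*} [Group W] {Mat : CoxeterMatrix B} (cs : CoxeterSystem Mat W)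

theorem bcov.to_bstep {x y : W} (h : bcov cs x y) : bstep cs x y := by
  obtain ⟨⟨hle, hne⟩, hcov⟩ := h
  obtain rfl | ⟨z, hxz, hzy⟩ := Relation.ReflTransGen.cases_head hle
  · exact absurd rfl hne
  · obtain rfl | rfl := hcov z (.single hxz) hzy
    · exact absurd hxz.2 (lt_irrefl _)
    · exact hxz

/-- If `y` covers `x`, and `i` is a right descent of `y` but not of `x`, then `y = x * s i`. -/
theorem bcov.eq_mul_simple {x y : W} {i : B} (h : bcov cs x y)
    (hx : cs.length x < cs.length (x * cs.simple i))
    (hy : ¬ cs.length y < cs.length (y * cs.simple i)) :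
    y = x * cs.simple i := by
  obtain ⟨⟨t, ht, rfl⟩, hlt⟩ := h.to_bstep
  have hinv : cs.IsRightInversion (x * t) t := ⟨ht, by simpa [mul_assoc, ht.mul_self] using hlt⟩
  obtain rfl | hlt' := hinv.eq_simple_or_length_lt (i := i)
  · rfl
  rw [mul_assoc x t t, ht.mul_self, mul_one] at hlt'
  have hy' := lt_of_le_of_ne (not_lt.1 hy) (cs.length_mul_simple_ne _ i)
  have hs := cs.isReflection_simple i
  have h₁ : bstep cs x (x * cs.simple i) := ⟨⟨_, hs, rfl⟩, hx⟩
  have h₂ : bstep cs (x * cs.simple i) (x * t * cs.simple i) :=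
    ⟨⟨cs.simple i * t * cs.simple i, by simpa using ht.conj (cs.simple i), by simp [mul_assoc]⟩,
      hlt'⟩
  have h₃ : bstep cs (x * t * cs.simple i) (x * t) := ⟨⟨_, hs, by simp⟩, hy'⟩
  obtain h | h := h.2 _ (.single h₁) ((Relation.ReflTransGen.single h₂).tail h₃)
  · exact absurd (congrArg cs.length h) hx.ne'
  · exact h.symm

end Covers

/-- Let `(W,S)` be a Coxeter system and `H ⊆ S`.  The Hasse diagram of
the Bruhat order contains no configuration of pairwise distinct elements
`f, d, u, b, c, a` with `f ⋖ d`, `f ⋖ u`, `d ⋖ b`, `d ⋖ c`, `u ⋖ b`, `u ⋖ c`,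
`b ⋖ a`, `c ⋖ a`, where `a, b, c ∉ W^H` and `u, f ∈ W^H`. -/
theorem stmt15 {B : Type*} {W : Type*} [Group W] {Mat : CoxeterMatrix B}
    (cs : CoxeterSystem Mat W) (H : Set B) :
    ¬ ∃ f d u b c a : W,
      List.Pairwise (· ≠ ·) [f, d, u, b, c, a] ∧
      bcov cs f d ∧ bcov cs f u ∧
      bcov cs d b ∧ bcov cs d c ∧ bcov cs u b ∧ bcov cs u c ∧
      bcov cs b a ∧ bcov cs c a ∧
      a ∉ WH cs H ∧ b ∉ WH cs H ∧ c ∉ WH cs H ∧ u ∈ WH cs H ∧ f ∈ WH cs H := by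
  rintro ⟨f, d, u, b, c, a, hne, hfd, -, hdb, hdc, hub, huc, -, -, -, hb, hc, hu, hf⟩
  simp only [List.pairwise_cons, List.mem_cons, ne_eq] at hne
  have hdu : d ≠ u := hne.2.1 u (by simp)
  have hbc : b ≠ c := hne.2.2.2.1 c (by simp)
  have key : ∀ x, bcov cs d x → bcov cs u x → x ∉ WH cs H →
      ∃ i, x = u * cs.simple i ∧ d = f * cs.simple i := by
    intro x hdx hux hx
    simp only [WH, Set.mem_ofPred_eq, not_forall] at hx
    obtain ⟨i, hi, hxi⟩ := hx
    have hxu := hux.eq_mul_simple cs (hu i hi) hxi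
    refine ⟨i, hxu, hfd.eq_mul_simple cs (hf i hi) fun hdi => hdu ?_⟩
    exact mul_right_cancel ((hdx.eq_mul_simple cs hdi hxi).symm.trans hxu)
  obtain ⟨i, hbi, hdi⟩ := key b hdb hub hb
  obtain ⟨j, hcj, hdj⟩ := key c hdc huc hc
  rw [hdi, mul_right_inj] at hdj
  exact hbc (by rw [hbi, hcj, hdj])
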